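/- arXiv:2512.00348 — 2 statements merged into one kernel-verified Lean document; each statement's English description precedes it below -/
import Mathlib

section
/- Let A ⊆ ℕ^n be finite and let r be an extreme ray of the SONC cone C(A). Then r = ℝ₊·f, where f belongs to one of the following three types of nonnegative circuit polynomials: (1) f(x) = x^β with β ∈ A ∩ (2ℕ)^n; (2) f is supported on a reduced circuit (S, β) on A with |S| > 1 and f(x) = Σ_{α∈S} c_α x^α − Θ_f x^β with all c_α > 0; (3) f is supported on a reduced circuit (S, β) on A with |S| > 1 and β odd (i.e., β ∉ (2ℕ)^n), and f(x) = Σ_{α∈S} c_α x^α + Θ_f x^β with all c_α > 0. -/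
open MvPolynomial Finset

/-- A lattice exponent is even if every entry is even. -/
def IsEvenPt {n : ℕ} (α : Fin n →₀ ℕ) : Prop := ∀ i, Even (α i)

/-- The embedding of a lattice exponent into `ℝⁿ`. -/
def toR {n : ℕ} (α : Fin n →₀ ℕ) : Fin n → ℝ := fun i => (α i : ℝ)

/-- `(S, β)` is a (simplicial) circuit on the ground set `A`:
`S ⊆ A ∩ (2ℕ)ⁿ` is affinely independent and `β ∈ A` lies in the relative
interior of `conv S`. -/
structure IsCircuitOn {n : ℕ} (A : Finset (Fin n →₀ ℕ)) (S : Finset (Fin n →₀ ℕ))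
    (β : Fin n →₀ ℕ) : Prop where
  subset : S ⊆ A
  even_mem : ∀ α ∈ S, IsEvenPt α
  beta_mem : β ∈ A
  indep : AffineIndependent ℝ (fun α : S => toR (α : Fin n →₀ ℕ))
  relint : toR β ∈ intrinsicInterior ℝ (convexHull ℝ (toR '' (S : Set (Fin n →₀ ℕ))))

/-- `lam` gives the barycentric coordinates of `β` with respect to `S`. -/
def IsBarycentric {n : ℕ} (S : Finset (Fin n →₀ ℕ)) (β : Fin n →₀ ℕ)
    (lam : (Fin n →₀ ℕ) → ℝ) : Prop :=
  (∀ α ∈ S, 0 < lam α) ∧ ∑ α ∈ S, lam α = 1 ∧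
    ∀ i, (β i : ℝ) = ∑ α ∈ S, lam α * (α i : ℝ)

/-- The circuit number `Θ = ∏_{α ∈ S} (c_α / λ_α) ^ (λ_α)`. -/
noncomputable def circuitNumber {n : ℕ} (S : Finset (Fin n →₀ ℕ))
    (c lam : (Fin n →₀ ℕ) → ℝ) : ℝ :=
  ∏ α ∈ S, (c α / lam α) ^ (lam α)

/-- The circuit polynomial `∑_{α ∈ S} c_α x^α + d x^β`. -/
noncomputable def circuitPoly {n : ℕ} (S : Finset (Fin n →₀ ℕ)) (β : Fin n →₀ ℕ)
    (c : (Fin n →₀ ℕ) → ℝ) (d : ℝ) : MvPolynomial (Fin n) ℝ :=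
  (∑ α ∈ S, monomial α (c α)) + monomial β d

/-- Generators of the SONC cone on `A`: nonnegative circuit polynomials on circuits
on `A`, together with monomial squares `x^α`, `α ∈ A ∩ (2ℕ)ⁿ`. -/
def SONCGen {n : ℕ} (A : Finset (Fin n →₀ ℕ)) : Set (MvPolynomial (Fin n) ℝ) :=
  {f | (∃ S β c d, IsCircuitOn A S β ∧ (∀ α ∈ S, 0 < c α) ∧
          f = circuitPoly S β c d ∧ ∀ x : Fin n → ℝ, 0 ≤ eval x f) ∨
       (∃ α ∈ A, IsEvenPt α ∧ f = monomial α 1)}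

/-- The SONC cone on `A`: all finite nonnegative combinations of the generators. -/
def SONCCone {n : ℕ} (A : Finset (Fin n →₀ ℕ)) : Set (MvPolynomial (Fin n) ℝ) :=
  {f | ∃ (k : ℕ) (g : Fin k → MvPolynomial (Fin n) ℝ) (μ : Fin k → ℝ),
        (∀ i, g i ∈ SONCGen A ∧ 0 ≤ μ i) ∧ f = ∑ i, μ i • g i}

/-- The ray `ℝ₊ · f`. -/
def raySet {n : ℕ} (f : MvPolynomial (Fin n) ℝ) : Set (MvPolynomial (Fin n) ℝ) :=
  {p | ∃ t : ℝ, 0 ≤ t ∧ p = t • f}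

/-- `ℝ₊ · f` is an extreme ray of the convex cone `K`. -/
def IsExtremeRay {n : ℕ} (K : Set (MvPolynomial (Fin n) ℝ))
    (f : MvPolynomial (Fin n) ℝ) : Prop :=
  f ≠ 0 ∧ f ∈ K ∧ ∀ g h, g ∈ K → h ∈ K → f = g + h → g ∈ raySet f ∧ h ∈ raySet f

/-- The ray `ℝ₊ · f` is an exposed face of `K`: some linear functional vanishes on
the ray and is strictly positive on the rest of `K`. -/
def IsExposedRay {n : ℕ} (K : Set (MvPolynomial (Fin n) ℝ))
    (f : MvPolynomial (Fin n) ℝ) : Prop :=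
  ∃ l : MvPolynomial (Fin n) ℝ →ₗ[ℝ] ℝ,
    (∀ p ∈ raySet f, l p = 0) ∧ ∀ g ∈ K \ raySet f, 0 < l g

/-- `(S, β)` is a reduced circuit on `A`: the only even points of `A` in `conv S`
are those of `S ∪ {β}`. -/
def IsReducedCircuitOn {n : ℕ} (A : Finset (Fin n →₀ ℕ)) (S : Finset (Fin n →₀ ℕ))
    (β : Fin n →₀ ℕ) : Prop :=
  IsCircuitOn A S β ∧
    {γ : Fin n →₀ ℕ | γ ∈ A ∧ IsEvenPt γ ∧
        toR γ ∈ convexHull ℝ (toR '' (S : Set (Fin n →₀ ℕ)))} =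
      {γ : Fin n →₀ ℕ | (γ ∈ S ∨ γ = β) ∧ IsEvenPt γ}

section Geometry

variable {n : ℕ} {S : Finset (Fin n →₀ ℕ)} {β : Fin n →₀ ℕ}

theorem toR_injective : Function.Injective (toR : (Fin n →₀ ℕ) → Fin n → ℝ) := by
  intro a b h
  ext i
  exact Nat.cast_injective (R := ℝ) (congrFun h i)

theorem affineIndependent_toR_iff :
    AffineIndependent ℝ (fun α : S => toR (α : Fin n →₀ ℕ)) ↔
      ∀ w : (Fin n →₀ ℕ) → ℝ, ∑ α ∈ S, w α = 0 → (∀ i, ∑ α ∈ S, w α * (α i : ℝ) = 0) →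
        ∀ α ∈ S, w α = 0 := by
  classical
  constructor
  · intro h w h0 h1 α hα
    refine affineIndependent_iff.1 h Finset.univ (fun a => w a) ?_ ?_ ⟨α, hα⟩ (Finset.mem_univ _)
    · rw [← h0]
      exact Finset.sum_coe_sort S w
    · ext i
      rw [Pi.zero_apply, ← h1 i, Finset.sum_apply]
      exact Finset.sum_coe_sort S (fun a => w a * (a i : ℝ))
  · intro h
    rw [affineIndependent_iff_of_fintype]
    intro w h0 h1 a
    rw [Finset.weightedVSub_eq_linear_combination _ h0] at h1
    have key := h (fun α => if hα : α ∈ S then w ⟨α, hα⟩ else 0) ?_ ?_ a a.2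
    · simpa using key
    · rw [← h0, ← Finset.sum_coe_sort S]
      simp
    · intro i
      have := congrFun h1 i
      rw [Finset.sum_apply, Pi.zero_apply] at this
      rw [← this, ← Finset.sum_coe_sort S]
      simp [toR]

/-- On an affinely independent set, every function is the restriction of an affine function. -/
theorem exists_linearMap_of_affineIndependent
    (h : AffineIndependent ℝ (fun α : S => toR (α : Fin n →₀ ℕ))) (v : (Fin n →₀ ℕ) → ℝ) :
    ∃ φ : (ℝ × (Fin n → ℝ)) →ₗ[ℝ] ℝ, ∀ α ∈ S, φ (1, toR α) = v α := by
  classical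
  have hli : LinearIndependent ℝ (fun α : S => ((1 : ℝ), toR (α : Fin n →₀ ℕ))) := by
    rw [Fintype.linearIndependent_iff]
    intro w hw a
    have h1 : ∑ x, w x = 0 := by simpa [Prod.fst_sum] using congrArg Prod.fst hw
    refine affineIndependent_iff.1 h Finset.univ w h1 ?_ a (Finset.mem_univ _)
    simpa [Prod.snd_sum] using congrArg Prod.snd hw
  obtain ⟨g, hg⟩ := LinearMap.exists_leftInverse_of_injective
    (Fintype.linearCombination ℝ (fun α : S => ((1 : ℝ), toR (α : Fin n →₀ ℕ))))
    (LinearMap.ker_eq_bot.2 hli.fintypeLinearCombination_injective)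
  refine ⟨(Fintype.linearCombination ℝ (fun α : S => v α)) ∘ₗ g, fun α hα => ?_⟩
  have h2 := congrArg (fun f => f (Pi.single (⟨α, hα⟩ : S) (1 : ℝ))) hg
  simp only [LinearMap.comp_apply, LinearMap.id_apply] at h2
  rw [Fintype.linearCombination_apply_single, one_smul] at h2
  rw [LinearMap.comp_apply, h2, Fintype.linearCombination_apply_single, one_smul]

theorem mem_convexHull_toR_iff {x : Fin n → ℝ} :
    x ∈ convexHull ℝ (toR '' (S : Set (Fin n →₀ ℕ))) ↔
      ∃ w : (Fin n →₀ ℕ) → ℝ, (∀ α ∈ S, 0 ≤ w α) ∧ ∑ α ∈ S, w α = 1 ∧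
        ∀ i, x i = ∑ α ∈ S, w α * (α i : ℝ) := by
  classical
  rw [← Finset.coe_image, Finset.mem_convexHull']
  constructor
  · rintro ⟨w, h0, h1, h2⟩
    rw [Finset.sum_image toR_injective.injOn] at h1 h2
    refine ⟨fun α => w (toR α), fun α hα => h0 _ (Finset.mem_image_of_mem _ hα), h1, fun i => ?_⟩
    rw [← h2, Finset.sum_apply]
    rfl
  · rintro ⟨w, h0, h1, h2⟩
    have hl : ∀ α : Fin n →₀ ℕ, Function.invFun toR (toR α) = α :=
      Function.leftInverse_invFun toR_injective
    refine ⟨fun y => w (Function.invFun toR y), ?_, ?_, ?_⟩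
    · intro y hy
      obtain ⟨α, hα, rfl⟩ := Finset.mem_image.1 hy
      simpa only [hl] using h0 α hα
    · rw [Finset.sum_image toR_injective.injOn]
      simpa only [hl] using h1
    · rw [Finset.sum_image toR_injective.injOn]
      ext i
      simp only [hl]
      rw [h2, Finset.sum_apply]
      rfl

theorem mem_intrinsicInterior_iff_nhdsWithin {s : Set (Fin n → ℝ)} {x : Fin n → ℝ} :
    x ∈ intrinsicInterior ℝ s ↔
      x ∈ affineSpan ℝ s ∧ s ∈ nhdsWithin x (affineSpan ℝ s : Set (Fin n → ℝ)) := by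
  rw [mem_intrinsicInterior]
  constructor
  · rintro ⟨y, hy, rfl⟩
    exact ⟨y.2, preimage_coe_mem_nhds_subtype.1 (mem_interior_iff_mem_nhds.1 hy)⟩
  · rintro ⟨hx, h⟩
    exact ⟨⟨x, hx⟩, mem_interior_iff_mem_nhds.2 (preimage_coe_mem_nhds_subtype.2 h), rfl⟩

/-- A point of the relative interior of a simplex has positive barycentric coordinates. -/
theorem exists_isBarycentric
    (h : AffineIndependent ℝ (fun α : S => toR (α : Fin n →₀ ℕ)))
    (hβ : toR β ∈ intrinsicInterior ℝ (convexHull ℝ (toR '' (S : Set (Fin n →₀ ℕ))))) :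
    ∃ lam, IsBarycentric S β lam := by
  classical
  obtain ⟨lam, h0, h1, h2⟩ := mem_convexHull_toR_iff.1 (intrinsicInterior_subset hβ)
  refine ⟨lam, fun α hα => ?_, h1, h2⟩
  obtain ⟨hs, hn⟩ := mem_intrinsicInterior_iff_nhdsWithin.1 hβ
  have hα' : toR α ∈ affineSpan ℝ (convexHull ℝ (toR '' (S : Set (Fin n →₀ ℕ)))) :=
    subset_affineSpan ℝ _ (subset_convexHull ℝ _ ⟨α, hα, rfl⟩)
  have ht : Filter.Tendsto (fun t : ℝ => AffineMap.lineMap (toR α) (toR β) t) (nhds 1)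
      (nhdsWithin (toR β)
        (affineSpan ℝ (convexHull ℝ (toR '' (S : Set (Fin n →₀ ℕ)))) : Set (Fin n → ℝ))) := by
    refine tendsto_nhdsWithin_iff.2 ⟨?_, Filter.Eventually.of_forall fun t =>
      AffineMap.lineMap_mem t hα' hs⟩
    have hc : Continuous (fun t : ℝ => AffineMap.lineMap (toR α) (toR β) t) :=
      AffineMap.lineMap_continuous
    simpa using hc.tendsto 1
  obtain ⟨t, ht1, htm⟩ := ((Filter.Eventually.filter_mono nhdsWithin_le_nhds
    (ht.eventually hn)).and (self_mem_nhdsWithin : Set.Ioi (1 : ℝ) ∈ nhdsWithin 1 (Set.Ioi 1))).exists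
  obtain ⟨ν, g0, g1, g2⟩ := mem_convexHull_toR_iff.1 ht1
  have htm : 1 < t := htm
  have key := affineIndependent_toR_iff.1 h
    (fun a => ν a - t * lam a - (1 - t) * if a = α then 1 else 0) ?_ ?_ α hα
  · simp only [if_true] at key
    have := g0 α hα
    by_contra! hle
    nlinarith
  · simp only [Finset.sum_sub_distrib, ← Finset.mul_sum, g1, h1, Finset.sum_ite_eq', hα, if_true]
    ring
  · intro i
    simp only [sub_mul, Finset.sum_sub_distrib, mul_assoc, ← Finset.mul_sum, ite_mul, one_mul,
      zero_mul, Finset.sum_ite_eq', hα, if_true, ← g2 i, ← h2 i]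
    simp only [AffineMap.lineMap_apply, toR, vsub_eq_sub, vadd_eq_add, Pi.add_apply,
      Pi.smul_apply, Pi.sub_apply, smul_eq_mul]
    ring

/-- A point with positive barycentric coordinates lies in the relative interior. -/
theorem IsBarycentric.mem_intrinsicInterior {lam : (Fin n →₀ ℕ) → ℝ}
    (hl : IsBarycentric S β lam)
    (h : AffineIndependent ℝ (fun α : S => toR (α : Fin n →₀ ℕ))) :
    toR β ∈ intrinsicInterior ℝ (convexHull ℝ (toR '' (S : Set (Fin n →₀ ℕ)))) := by
  classical
  obtain ⟨h0, h1, h2⟩ := hl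
  have hb : toR β ∈ convexHull ℝ (toR '' (S : Set (Fin n →₀ ℕ))) :=
    mem_convexHull_toR_iff.2 ⟨lam, fun α hα => (h0 α hα).le, h1, h2⟩
  refine mem_intrinsicInterior_iff_nhdsWithin.2 ⟨subset_affineSpan ℝ _ hb, ?_⟩
  choose φ hφ using fun a => exists_linearMap_of_affineIndependent h (Pi.single a 1)
  have hspan : ∀ x ∈ affineSpan ℝ (convexHull ℝ (toR '' (S : Set (Fin n →₀ ℕ)))),
      ∑ a ∈ S, φ a (1, x) = 1 ∧ ∀ i, x i = ∑ a ∈ S, φ a (1, x) * (a i : ℝ) := by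
    intro x hx
    rw [affineSpan_convexHull] at hx
    refine affineSpan_induction hx ?_ ?_
    · rintro _ ⟨α, hα, rfl⟩
      have hα : α ∈ S := hα
      have : ∀ a, φ a (1, toR α) = if α = a then 1 else 0 := by
        intro a
        rw [hφ a α hα, Pi.single_apply]
      simp only [this, Finset.sum_ite_eq, hα, if_true, ite_mul, one_mul, zero_mul, true_and]
      exact fun i => rfl
    · intro c u v w hu hv hw
      have e : ∀ a, φ a (1, c • (u -ᵥ v) +ᵥ w) =
          c * (φ a (1, u) - φ a (1, v)) + φ a (1, w) := by
        intro a
        rw [← map_sub, ← smul_eq_mul, ← map_smul, ← map_add]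
        simp
      simp only [e, add_mul, sub_mul, Finset.sum_add_distrib, mul_assoc, ← Finset.mul_sum,
        Finset.sum_sub_distrib, hu.1, hv.1, hw.1, ← hu.2, ← hv.2, ← hw.2]
      simp
  have hβ : ∀ a ∈ S, φ a (1, toR β) = lam a := by
    intro a ha
    obtain ⟨e1, e2⟩ := hspan _ (subset_affineSpan ℝ _ hb)
    have := affineIndependent_toR_iff.1 h (fun a => φ a (1, toR β) - lam a) (by
      rw [Finset.sum_sub_distrib, e1, h1, sub_self]) (by
      intro i
      simp only [sub_mul, Finset.sum_sub_distrib, ← e2, ← h2 i]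
      simp [toR]) a ha
    exact sub_eq_zero.1 this
  have hopen : ∀ᶠ x in nhds (toR β), ∀ a ∈ S, 0 < φ a (1, x) := by
    rw [Filter.eventually_all_finset]
    intro a ha
    have hc : Continuous (fun x : Fin n → ℝ => φ a (1, x)) :=
      (LinearMap.continuous_of_finiteDimensional (φ a)).comp (by fun_prop)
    refine hc.continuousAt.eventually (lt_mem_nhds ?_)
    simpa only [hβ a ha] using h0 a ha
  filter_upwards [mem_nhdsWithin_of_mem_nhds hopen, self_mem_nhdsWithin] with x hx hxs
  exact mem_convexHull_toR_iff.2 ⟨fun a => φ a (1, x), fun a ha => (hx a ha).le, hspan x hxs⟩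

/-- A relative interior point of a simplex with at least two vertices is not a vertex. -/
theorem IsBarycentric.notMem {lam : (Fin n →₀ ℕ) → ℝ} (hl : IsBarycentric S β lam)
    (h : AffineIndependent ℝ (fun α : S => toR (α : Fin n →₀ ℕ))) (hS : 1 < S.card) :
    β ∉ S := by
  classical
  intro hβ
  obtain ⟨α, hα, hne⟩ := Finset.exists_mem_ne hS β
  have := affineIndependent_toR_iff.1 h (fun a => lam a - if a = β then 1 else 0) (by
    simp [Finset.sum_sub_distrib, hl.2.1, hβ]) (by
    intro i
    simp [sub_mul, Finset.sum_sub_distrib, ← hl.2.2 i, hβ]) α hα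
  simp only [hne, if_false, sub_zero] at this
  exact (hl.1 α hα).ne' this

end Geometry

section CircuitPolynomial

variable {n : ℕ} {S : Finset (Fin n →₀ ℕ)} {β : Fin n →₀ ℕ} {c lam : (Fin n →₀ ℕ) → ℝ} {d : ℝ}

theorem eval_circuitPoly (x : Fin n → ℝ) :
    eval x (circuitPoly S β c d) = ∑ α ∈ S, c α * ∏ i, x i ^ α i + d * ∏ i, x i ^ β i := by
  simp [circuitPoly, eval_monomial, Finsupp.prod_fintype]

theorem coeff_circuitPoly (γ : Fin n →₀ ℕ) :
    coeff γ (circuitPoly S β c d) = (if γ ∈ S then c γ else 0) + if β = γ then d else 0 := by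
  classical
  simp [circuitPoly, coeff_sum, coeff_monomial]

theorem smul_circuitPoly (s : ℝ) :
    s • circuitPoly S β c d = circuitPoly S β (fun α => s * c α) (s * d) := by
  simp [circuitPoly, Finset.smul_sum, smul_monomial]

theorem circuitNumber_pos (hc : ∀ α ∈ S, 0 < c α) (hl : ∀ α ∈ S, 0 < lam α) :
    0 < circuitNumber S c lam :=
  Finset.prod_pos fun α hα => Real.rpow_pos_of_pos (div_pos (hc α hα) (hl α hα)) _

theorem IsEvenPt.prod_abs_pow {α : Fin n →₀ ℕ} (hα : IsEvenPt α) (x : Fin n → ℝ) :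
    ∏ i, |x i| ^ α i = ∏ i, x i ^ α i :=
  Finset.prod_congr rfl fun i _ => (hα i).pow_abs (x i)

/-- The weighted inequality of arithmetic and geometric means for circuits. -/
theorem IsBarycentric.circuitNumber_mul_prod_le (hl : IsBarycentric S β lam)
    (hc : ∀ α ∈ S, 0 < c α) {y : Fin n → ℝ} (hy : ∀ i, 0 ≤ y i) :
    circuitNumber S c lam * ∏ i, y i ^ β i ≤ ∑ α ∈ S, c α * ∏ i, y i ^ α i := by
  obtain ⟨h0, h1, h2⟩ := hl
  have hp : ∀ α : Fin n →₀ ℕ, 0 ≤ ∏ i, y i ^ α i :=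
    fun α => Finset.prod_nonneg fun i _ => pow_nonneg (hy i) _
  have key := Real.geom_mean_le_arith_mean_weighted S lam
    (fun α => c α / lam α * ∏ i, y i ^ α i) (fun α hα => (h0 α hα).le) h1
    (fun α hα => mul_nonneg (div_pos (hc α hα) (h0 α hα)).le (hp α))
  have e1 : ∑ α ∈ S, lam α * (c α / lam α * ∏ i, y i ^ α i) = ∑ α ∈ S, c α * ∏ i, y i ^ α i :=
    Finset.sum_congr rfl fun α hα => by
      have := (h0 α hα).ne'
      field_simp
  have e2 : ∏ α ∈ S, (c α / lam α * ∏ i, y i ^ α i) ^ lam α =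
      circuitNumber S c lam * ∏ i, y i ^ β i := by
    rw [circuitNumber, Finset.prod_congr rfl fun α hα =>
      Real.mul_rpow (div_pos (hc α hα) (h0 α hα)).le (hp α), Finset.prod_mul_distrib]
    congr 1
    rw [Finset.prod_congr rfl fun α _ =>
      (Real.finsetProd_rpow _ _ (fun i _ => pow_nonneg (hy i) (α i)) (lam α)).symm,
      Finset.prod_comm]
    refine Finset.prod_congr rfl fun i _ => ?_
    rw [← Real.rpow_natCast (y i) (β i), h2 i, Real.rpow_sum_of_nonneg (hy i)
      (fun α hα => mul_nonneg (h0 α hα).le (Nat.cast_nonneg _))]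
    refine Finset.prod_congr rfl fun α _ => ?_
    rw [← Real.rpow_natCast_mul (hy i), mul_comm]
  rwa [e1, e2] at key

theorem IsBarycentric.eval_circuitPoly_nonneg (hl : IsBarycentric S β lam)
    (hS : ∀ α ∈ S, IsEvenPt α) (hc : ∀ α ∈ S, 0 < c α) (hd : |d| ≤ circuitNumber S c lam)
    (x : Fin n → ℝ) : 0 ≤ eval x (circuitPoly S β c d) := by
  have key := hl.circuitNumber_mul_prod_le hc (y := fun i => |x i|) fun i => abs_nonneg _
  rw [eval_circuitPoly]
  rw [Finset.sum_congr rfl fun α hα => by rw [(hS α hα).prod_abs_pow x]] at key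
  have h1 : |d * ∏ i, x i ^ β i| ≤ circuitNumber S c lam * ∏ i, |x i| ^ β i := by
    rw [abs_mul, Finset.abs_prod]
    simp only [abs_pow]
    exact mul_le_mul_of_nonneg_right hd
      (Finset.prod_nonneg fun i _ => pow_nonneg (abs_nonneg _) _)
  have := neg_abs_le (d * ∏ i, x i ^ β i)
  linarith

/-- Equality in the arithmetic-geometric mean inequality is attained at a positive point. -/
theorem IsBarycentric.exists_pos_eq (hl : IsBarycentric S β lam)
    (h : AffineIndependent ℝ (fun α : S => toR (α : Fin n →₀ ℕ))) (hc : ∀ α ∈ S, 0 < c α) :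
    ∃ y : Fin n → ℝ, (∀ i, 0 < y i) ∧
      ∑ α ∈ S, c α * ∏ i, y i ^ α i = circuitNumber S c lam * ∏ i, y i ^ β i := by
  classical
  obtain ⟨h0, h1, h2⟩ := hl
  obtain ⟨φ, hφ⟩ := exists_linearMap_of_affineIndependent h (fun α => -Real.log (c α / lam α))
  set s : Fin n → ℝ := fun i => φ (0, Pi.single i 1) with hs
  set κ : ℝ := φ (1, 0) with hκ
  have hexp : ∀ α : Fin n →₀ ℕ, φ (1, toR α) = κ + ∑ i, (α i : ℝ) * s i := by
    intro α
    have : ((1 : ℝ), toR α) = (1, 0) + ∑ i, (α i : ℝ) • ((0 : ℝ), Pi.single i (1 : ℝ)) := by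
      ext j
      · simp [Prod.fst_sum]
      · simp [Prod.snd_sum, toR, Finset.sum_apply, Pi.single_apply]
    rw [this, map_add, map_sum]
    simp only [map_smul, smul_eq_mul, hs, hκ]
  have hprod : ∀ α : Fin n →₀ ℕ,
      ∏ i, Real.exp (s i) ^ α i = Real.exp (∑ i, (α i : ℝ) * s i) := by
    intro α
    rw [Real.exp_sum]
    exact Finset.prod_congr rfl fun i _ => (Real.exp_nat_mul _ _).symm
  have hpos : ∀ α ∈ S, 0 < c α / lam α := fun α hα => div_pos (hc α hα) (h0 α hα)
  refine ⟨fun i => Real.exp (s i), fun i => Real.exp_pos _, ?_⟩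
  have e1 : ∀ α ∈ S, c α * ∏ i, Real.exp (s i) ^ α i = lam α * Real.exp (-κ) := by
    intro α hα
    have : ∑ i, (α i : ℝ) * s i = -Real.log (c α / lam α) + -κ := by
      have := hφ α hα
      rw [hexp] at this
      linarith
    rw [hprod, this, Real.exp_add, Real.exp_neg, Real.exp_log (hpos α hα)]
    have := (hc α hα).ne'
    have := (h0 α hα).ne'
    field_simp
  rw [Finset.sum_congr rfl e1, ← Finset.sum_mul, h1, one_mul, hprod]
  have e2 : circuitNumber S c lam = Real.exp (∑ α ∈ S, lam α * Real.log (c α / lam α)) := by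
    rw [circuitNumber, Real.exp_sum]
    refine Finset.prod_congr rfl fun α hα => ?_
    rw [Real.rpow_def_of_pos (hpos α hα), mul_comm]
  have e3 : ∑ i, (β i : ℝ) * s i = ∑ α ∈ S, lam α * (-Real.log (c α / lam α) - κ) := by
    have : ∀ α ∈ S, lam α * (-Real.log (c α / lam α) - κ) = ∑ i, lam α * (α i : ℝ) * s i := by
      intro α hα
      rw [← hφ α hα, hexp, add_sub_cancel_left, Finset.mul_sum]
      exact Finset.sum_congr rfl fun i _ => (mul_assoc _ _ _).symm
    rw [Finset.sum_congr rfl this, Finset.sum_comm]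
    exact Finset.sum_congr rfl fun i _ => by rw [h2 i, Finset.sum_mul]
  rw [e2, ← Real.exp_add, e3, ← Finset.sum_add_distrib]
  congr 1
  rw [Finset.sum_congr rfl (g := fun α => lam α * -κ) fun α _ => by ring, ← Finset.sum_mul, h1,
    one_mul]

theorem IsBarycentric.neg_circuitNumber_le (hl : IsBarycentric S β lam)
    (h : AffineIndependent ℝ (fun α : S => toR (α : Fin n →₀ ℕ))) (hc : ∀ α ∈ S, 0 < c α)
    (hd : ∀ x, 0 ≤ eval x (circuitPoly S β c d)) : -circuitNumber S c lam ≤ d := by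
  obtain ⟨y, hy, he⟩ := hl.exists_pos_eq h hc
  have := hd y
  rw [eval_circuitPoly, he, ← add_mul] at this
  have := nonneg_of_mul_nonneg_left this (Finset.prod_pos fun i _ => pow_pos (hy i) (β i))
  linarith

theorem IsBarycentric.le_circuitNumber (hl : IsBarycentric S β lam)
    (h : AffineIndependent ℝ (fun α : S => toR (α : Fin n →₀ ℕ))) (hc : ∀ α ∈ S, 0 < c α)
    (hS : ∀ α ∈ S, IsEvenPt α) (hβ : ¬ IsEvenPt β)
    (hd : ∀ x, 0 ≤ eval x (circuitPoly S β c d)) : d ≤ circuitNumber S c lam := by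
  classical
  obtain ⟨y, hy, he⟩ := hl.exists_pos_eq h hc
  obtain ⟨j, hj⟩ := not_forall.1 hβ
  have hflip : ∀ α : Fin n →₀ ℕ, ∏ i, (Function.update (1 : Fin n → ℝ) j (-1) i * y i) ^ α i =
      (-1) ^ α j * ∏ i, y i ^ α i := by
    intro α
    simp only [mul_pow, Finset.prod_mul_distrib]
    congr 1
    rw [Finset.prod_eq_single j]
    · simp
    · intro i _ hij
      simp [hij]
    · simp
  have := hd (fun i => Function.update (1 : Fin n → ℝ) j (-1) i * y i)
  rw [eval_circuitPoly] at this
  simp only [hflip] at this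
  rw [Finset.sum_congr rfl fun α hα => by rw [(hS α hα j).neg_one_pow, one_mul], he,
    (Nat.not_even_iff_odd.1 hj).neg_one_pow, ← mul_assoc, ← add_mul] at this
  have := nonneg_of_mul_nonneg_left this (Finset.prod_pos fun i _ => pow_pos (hy i) (β i))
  linarith

end CircuitPolynomial

section Cone

variable {n : ℕ} {A S : Finset (Fin n →₀ ℕ)} {β γ : Fin n →₀ ℕ} {c lam : (Fin n →₀ ℕ) → ℝ}
  {d : ℝ}

theorem IsBarycentric.isCircuitOn (hl : IsBarycentric S β lam) (hSA : S ⊆ A)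
    (hS : ∀ α ∈ S, IsEvenPt α) (hβ : β ∈ A)
    (h : AffineIndependent ℝ (fun α : S => toR (α : Fin n →₀ ℕ))) : IsCircuitOn A S β :=
  ⟨hSA, hS, hβ, h, hl.mem_intrinsicInterior h⟩

theorem smul_mem_SONCCone {g : MvPolynomial (Fin n) ℝ} (hg : g ∈ SONCGen A) {s : ℝ}
    (hs : 0 ≤ s) : s • g ∈ SONCCone A :=
  ⟨1, fun _ => g, fun _ => s, fun _ => ⟨hg, hs⟩, by simp⟩

theorem mem_SONCCone_of_mem_SONCGen {g : MvPolynomial (Fin n) ℝ} (hg : g ∈ SONCGen A) :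
    g ∈ SONCCone A := by
  simpa using smul_mem_SONCCone hg zero_le_one

theorem IsBarycentric.circuitPoly_mem_SONCGen (hl : IsBarycentric S β lam)
    (hS : IsCircuitOn A S β) (hc : ∀ α ∈ S, 0 < c α) (hd : |d| ≤ circuitNumber S c lam) :
    circuitPoly S β c d ∈ SONCGen A :=
  Or.inl ⟨S, β, c, d, hS, hc, rfl, hl.eval_circuitPoly_nonneg hS.even_mem hc hd⟩

theorem circuitNumber_mul {w : (Fin n →₀ ℕ) → ℝ} (hl : ∀ α ∈ S, 0 < lam α) :
    circuitNumber S (fun α => lam α * w α) lam = ∏ α ∈ S, w α ^ lam α :=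
  Finset.prod_congr rfl fun α hα => by rw [mul_div_cancel_left₀ _ (hl α hα).ne']

/-- An extreme ray of the cone is spanned by one of its generators. -/
theorem IsExtremeRay.exists_generator {f : MvPolynomial (Fin n) ℝ}
    (hf : IsExtremeRay (SONCCone A) f) : ∃ g ∈ SONCGen A, ∃ s : ℝ, 0 < s ∧ f = s • g := by
  classical
  obtain ⟨hne, ⟨k, g, μ, hg, hsum⟩, hext⟩ := hf
  obtain ⟨i, -, hi⟩ := Finset.exists_ne_zero_of_sum_ne_zero (hsum ▸ hne)
  have hrest : ∑ j, (Function.update μ i 0) j • g j ∈ SONCCone A := by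
    refine ⟨k, g, Function.update μ i 0, fun j => ⟨(hg j).1, ?_⟩, rfl⟩
    by_cases hj : j = i
    · simp [hj]
    · simpa [hj] using (hg j).2
  have hsplit : f = μ i • g i + ∑ j, (Function.update μ i 0) j • g j := by
    rw [hsum, ← Finset.add_sum_erase _ _ (Finset.mem_univ i),
      ← Finset.add_sum_erase (a := i) _ (fun j => (Function.update μ i 0) j • g j)
        (Finset.mem_univ i)]
    simp only [Function.update_self, zero_smul, zero_add]
    congr 1
    refine Finset.sum_congr rfl fun j hj => ?_
    rw [Function.update_of_ne (Finset.ne_of_mem_erase hj)]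
  obtain ⟨t, ht, he⟩ := (hext _ _ (smul_mem_SONCCone (hg i).1 (hg i).2) hrest hsplit).1
  have ht0 : t ≠ 0 := by
    rintro rfl
    exact hi (by rw [he, zero_smul])
  have hμ0 : μ i ≠ 0 := by
    intro h0
    exact hi (by rw [h0, zero_smul])
  refine ⟨g i, (hg i).1, t⁻¹ * μ i, mul_pos (inv_pos.2 (lt_of_le_of_ne ht ht0.symm))
    (lt_of_le_of_ne (hg i).2 hμ0.symm), ?_⟩
  rw [mul_smul, he, smul_smul, inv_mul_cancel₀ ht0, one_smul]

theorem raySet_smul {s : ℝ} (hs : 0 < s) (g : MvPolynomial (Fin n) ℝ) :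
    raySet (s • g) = raySet g := by
  ext p
  constructor
  · rintro ⟨t, ht, rfl⟩
    exact ⟨t * s, by positivity, by rw [smul_smul]⟩
  · rintro ⟨t, ht, rfl⟩
    exact ⟨t / s, by positivity, by rw [smul_smul, div_mul_cancel₀ _ hs.ne']⟩

theorem SONCGen.eq_circuitPoly_or_monomial {f : MvPolynomial (Fin n) ℝ} (hf : f ∈ SONCGen A)
    {s : ℝ} (hs : 0 < s) :
    (∃ S β c d, IsCircuitOn A S β ∧ (∀ α ∈ S, 0 < c α) ∧ s • f = circuitPoly S β c d ∧
      ∀ x : Fin n → ℝ, 0 ≤ eval x (s • f)) ∨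
    ∃ α ∈ A, IsEvenPt α ∧ raySet (s • f) = raySet (monomial α 1) := by
  rcases hf with ⟨S, β, c, d, hS, hc, rfl, hx⟩ | ⟨α, hα, hev, rfl⟩
  · refine Or.inl ⟨S, β, _, _, hS, fun α hα => mul_pos hs (hc α hα), smul_circuitPoly s,
      fun x => ?_⟩
    rw [smul_eval]
    exact mul_nonneg hs.le (hx x)
  · exact Or.inr ⟨α, hα, hev, raySet_smul hs _⟩

/-- An extreme circuit polynomial has inner coefficient `± Θ`, and the sign is negative when
the inner exponent is even. -/
theorem IsExtremeRay.eq_circuitNumber (hf : IsExtremeRay (SONCCone A) (circuitPoly S β c d))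
    (hS : IsCircuitOn A S β) (hcard : 1 < S.card) (hc : ∀ α ∈ S, 0 < c α)
    (hl : IsBarycentric S β lam) (hx : ∀ x, 0 ≤ eval x (circuitPoly S β c d)) :
    d = -circuitNumber S c lam ∨ (¬ IsEvenPt β ∧ d = circuitNumber S c lam) := by
  classical
  have hβS := hl.notMem hS.indep hcard
  have hΘ := circuitNumber_pos hc hl.1
  have hlow := hl.neg_circuitNumber_le hS.indep hc hx
  obtain ⟨α, hα⟩ : S.Nonempty := Finset.card_pos.1 (by omega)
  have hαβ : β ≠ α := by
    rintro rfl
    exact hβS hα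
  set Θ := circuitNumber S c lam with hΘdef
  have hmem : ∀ e, |e| ≤ Θ → circuitPoly S β c e ∈ SONCGen A :=
    fun e he => hl.circuitPoly_mem_SONCGen hS hc he
  by_contra! hcon
  obtain ⟨hne, hodd⟩ := hcon
  by_cases hβ : IsEvenPt β
  · have hsplit : circuitPoly S β c d = (d + Θ) • monomial β 1 + circuitPoly S β c (-Θ) := by
      rw [circuitPoly, circuitPoly, smul_monomial, add_left_comm, ← map_add]
      simp
    obtain ⟨t, -, he⟩ := (hf.2.2 _ _
      (smul_mem_SONCCone (Or.inr ⟨β, hS.beta_mem, hβ, rfl⟩) (by linarith))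
      (mem_SONCCone_of_mem_SONCGen (hmem (-Θ) (by rw [abs_neg, abs_of_pos hΘ]))) hsplit).1
    have h1 := congrArg (coeff α) he
    have h2 := congrArg (coeff β) he
    simp only [coeff_smul, coeff_monomial, coeff_circuitPoly, hα, hαβ, if_false, if_true, hβS,
      smul_eq_mul, mul_zero, add_zero, zero_add, mul_one] at h1 h2
    have ht : t = 0 := by
      rcases mul_eq_zero.1 h1.symm with h | h
      · exact h
      · exact absurd h (hc α hα).ne'
    rw [ht, zero_mul] at h2
    exact hne (by linarith)
  · have hup := hl.le_circuitNumber hS.indep hc hS.even_mem hβ hx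
    have hd1 : d ≠ Θ := hodd hβ
    have hsplit : circuitPoly S β c d = ((Θ + d) / (2 * Θ)) • circuitPoly S β c Θ +
        ((Θ - d) / (2 * Θ)) • circuitPoly S β c (-Θ) := by
      ext m
      simp only [coeff_add, coeff_smul, coeff_circuitPoly, smul_eq_mul]
      split_ifs <;> field_simp <;> ring
    obtain ⟨t, -, he⟩ := (hf.2.2 _ _
      (smul_mem_SONCCone (hmem Θ (by rw [abs_of_pos hΘ]))
        (div_nonneg (by linarith) (by linarith)))
      (smul_mem_SONCCone (hmem (-Θ) (by rw [abs_neg, abs_of_pos hΘ]))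
        (div_nonneg (by linarith) (by linarith))) hsplit).1
    have h1 := congrArg (coeff α) he
    have h2 := congrArg (coeff β) he
    simp only [coeff_smul, coeff_circuitPoly, hα, hαβ, if_false, if_true, hβS,
      smul_eq_mul, add_zero, zero_add] at h1 h2
    rw [← mul_right_cancel₀ (hc α hα).ne' h1] at h2
    rcases mul_eq_mul_left_iff.1 h2 with h | h
    · exact hd1 h.symm
    · rw [div_eq_zero_iff] at h
      rcases h with h | h
      · exact hne (by linarith)
      · linarith

/-- If the simplex of a circuit contains a further even point `γ` of `A`, then an extremal circuit
polynomial splits into two generators in which `x ^ γ` appears with opposite signs. -/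
theorem exists_split_of_mem_convexHull (hS : IsCircuitOn A S β) (hc : ∀ α ∈ S, 0 < c α)
    (hl : IsBarycentric S β lam) (hd : |d| = circuitNumber S c lam) (hγA : γ ∈ A)
    (hγ : IsEvenPt γ) (hconv : toR γ ∈ convexHull ℝ (toR '' (S : Set (Fin n →₀ ℕ))))
    (hγS : γ ∉ S) :
    ∃ g ∈ SONCGen A, ∃ h ∈ SONCGen A, circuitPoly S β c d = g + h ∧ coeff γ g ≠ 0 := by
  classical
  obtain ⟨μ, m0, m1, m2⟩ := mem_convexHull_toR_iff.1 hconv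
  obtain ⟨l0, l1, l2⟩ := id hl
  -- the face of `S` containing `γ` in its relative interior
  set P := S.filter (fun α => 0 < μ α) with hP
  have hμP : ∀ α ∈ S, α ∉ P → μ α = 0 := by
    intro α hα hαP
    have := m0 α hα
    simp only [hP, Finset.mem_filter, hα, true_and, not_lt] at hαP
    linarith
  have hPS : P ⊆ S := Finset.filter_subset _ _
  have hPsum : ∀ F : (Fin n →₀ ℕ) → ℝ, ∑ α ∈ P, μ α * F α = ∑ α ∈ S, μ α * F α := fun F =>
    Finset.sum_subset hPS fun α hα hαP => by rw [hμP α hα hαP, zero_mul]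
  have hPpos : ∀ α ∈ P, 0 < μ α := fun α hα => (Finset.mem_filter.1 hα).2
  have hbarP : IsBarycentric P γ μ :=
    ⟨hPpos, by simpa [m1] using hPsum (fun _ => 1), fun i => by rw [hPsum]; exact m2 i⟩
  have hPne : P.Nonempty := by
    rw [Finset.nonempty_iff_ne_empty]
    intro he
    have := hbarP.2.1
    simp [he] at this
  -- the largest multiple of `μ` below `lam`
  obtain ⟨α₀, hα₀, hmin⟩ := P.exists_min_image (fun α => lam α / μ α) hPne
  set t := lam α₀ / μ α₀ with ht
  have htpos : 0 < t := div_pos (l0 _ (hPS hα₀)) (hPpos _ hα₀)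
  have hle : ∀ α ∈ S, 0 ≤ lam α - t * μ α := by
    intro α hα
    by_cases hαP : α ∈ P
    · have := (le_div_iff₀ (hPpos α hαP)).1 (hmin α hαP)
      linarith
    · rw [hμP α hα hαP, mul_zero, sub_zero]
      exact (l0 α hα).le
  have hα₀0 : lam α₀ - t * μ α₀ = 0 := by
    rw [ht, div_mul_cancel₀ _ (hPpos _ hα₀).ne', sub_self]
  set T := S.filter (fun α => 0 < lam α - t * μ α) with hT
  have hTS : T ⊆ S := Finset.filter_subset _ _
  have hTpos : ∀ α ∈ T, 0 < lam α - t * μ α := fun α hα => (Finset.mem_filter.1 hα).2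
  have hT0 : ∀ α ∈ S, α ∉ T → lam α - t * μ α = 0 := by
    intro α hα hαT
    have := hle α hα
    simp only [hT, Finset.mem_filter, hα, true_and, not_lt] at hαT
    linarith
  have hα₀T : α₀ ∉ T := fun h => (hTpos _ h).ne' hα₀0
  have hγT : γ ∉ T := fun h => hγS (hTS h)
  have hγP : γ ∉ P := fun h => hγS (hPS h)
  have hTsum : ∀ F : (Fin n →₀ ℕ) → ℝ, ∑ α ∈ T, (lam α - t * μ α) * F α =
      ∑ α ∈ S, lam α * F α - t * ∑ α ∈ S, μ α * F α := fun F => by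
    rw [Finset.sum_subset hTS fun α hα hαT => by rw [hT0 α hα hαT, zero_mul], Finset.mul_sum,
      ← Finset.sum_sub_distrib]
    exact Finset.sum_congr rfl fun α _ => by ring
  set ν : (Fin n →₀ ℕ) → ℝ := fun α => if α = γ then t else lam α - t * μ α with hν
  have hνγ : ν γ = t := if_pos rfl
  have hνT : ∀ α ∈ T, ν α = lam α - t * μ α := fun α hα =>
    if_neg fun h : α = γ => hγT (h ▸ hα)
  have hbarT : IsBarycentric (insert γ T) β ν := by
    refine ⟨?_, ?_, fun i => ?_⟩
    · intro α hα
      rcases Finset.mem_insert.1 hα with rfl | hα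
      · rw [hνγ]; exact htpos
      · rw [hνT α hα]; exact hTpos α hα
    · rw [Finset.sum_insert hγT, hνγ, Finset.sum_congr rfl hνT]
      have := hTsum (fun _ => 1)
      simp only [mul_one, l1, m1] at this
      rw [this]; ring
    · rw [Finset.sum_insert hγT, hνγ, Finset.sum_congr rfl fun α hα => by rw [hνT α hα],
        hTsum, ← l2, ← m2]
      simp [toR]
  have hindS := affineIndependent_toR_iff.1 hS.indep
  have hindP : AffineIndependent ℝ (fun α : P => toR (α : Fin n →₀ ℕ)) := by
    refine affineIndependent_toR_iff.2 fun w w0 w1 α hα => ?_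
    have := hindS (fun α => if α ∈ P then w α else 0) (by
      rw [← Finset.sum_filter, Finset.filter_mem_eq_inter, Finset.inter_eq_right.2 hPS, w0])
      (by
        intro i
        simp only [ite_mul, zero_mul]
        rw [← Finset.sum_filter, Finset.filter_mem_eq_inter, Finset.inter_eq_right.2 hPS, w1])
      α (hPS hα)
    simpa [hα] using this
  have hindT : AffineIndependent ℝ
      (fun α : (insert γ T : Finset (Fin n →₀ ℕ)) => toR (α : Fin n →₀ ℕ)) := by
    refine affineIndependent_toR_iff.2 fun w w0 w1 => ?_
    rw [Finset.sum_insert hγT] at w0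
    simp only [Finset.sum_insert hγT] at w1
    have key := hindS (fun α => (if α ∈ T then w α else 0) + w γ * μ α) (by
      rw [Finset.sum_add_distrib, ← Finset.sum_filter, Finset.filter_mem_eq_inter,
        Finset.inter_eq_right.2 hTS, ← Finset.mul_sum, m1]
      linarith) (by
      intro i
      simp only [add_mul, ite_mul, zero_mul, mul_assoc]
      rw [Finset.sum_add_distrib, ← Finset.sum_filter, Finset.filter_mem_eq_inter,
        Finset.inter_eq_right.2 hTS, ← Finset.mul_sum, ← m2]
      have := w1 i
      simp only [toR]
      linarith)
    have hwγ : w γ = 0 := by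
      have := key α₀ (hPS hα₀)
      simp only [hα₀T, if_false, zero_add] at this
      exact (mul_eq_zero.1 this).resolve_right (hPpos _ hα₀).ne'
    intro α hα
    rcases Finset.mem_insert.1 hα with rfl | hα
    · exact hwγ
    · simpa [hα, hwγ] using key α (hTS hα)
  -- the coefficients of the two summands
  set w : (Fin n →₀ ℕ) → ℝ := fun α => c α / lam α with hw
  have hwpos : ∀ α ∈ S, 0 < w α := fun α hα => div_pos (hc α hα) (l0 α hα)
  have hlw : ∀ α ∈ S, lam α * w α = c α := fun α hα => mul_div_cancel₀ _ (l0 α hα).ne'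
  set W := ∏ α ∈ S, w α ^ μ α with hW
  have hWpos : 0 < W := Finset.prod_pos fun α hα => Real.rpow_pos_of_pos (hwpos α hα) _
  set w' : (Fin n →₀ ℕ) → ℝ := fun α => if α = γ then W else w α with hw'
  have hw'γ : w' γ = W := if_pos rfl
  have hw'T : ∀ α ∈ T, w' α = w α := fun α hα => if_neg fun h : α = γ => hγT (h ▸ hα)
  have hΘP : circuitNumber P (fun α => μ α * (t * w α)) μ = t * W := by
    rw [circuitNumber_mul hPpos, Finset.prod_congr rfl fun α hα =>
      Real.mul_rpow htpos.le (hwpos α (hPS hα)).le, Finset.prod_mul_distrib,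
      ← Real.rpow_sum_of_pos htpos, hbarP.2.1, Real.rpow_one, hW]
    congr 1
    exact Finset.prod_subset hPS fun α hα hαP => by rw [hμP α hα hαP, Real.rpow_zero]
  have hΘT : circuitNumber (insert γ T) (fun α => ν α * w' α) ν = circuitNumber S c lam := by
    rw [circuitNumber_mul hbarT.1, Finset.prod_insert hγT, hνγ, hw'γ,
      Finset.prod_congr rfl fun α hα => by rw [hνT α hα, hw'T α hα],
      Finset.prod_subset hTS fun α hα hαT => by rw [hT0 α hα hαT, Real.rpow_zero], hW,
      ← Real.finsetProd_rpow _ _ fun α hα => (Real.rpow_pos_of_pos (hwpos α hα) _).le,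
      ← Finset.prod_mul_distrib, circuitNumber]
    refine Finset.prod_congr rfl fun α hα => ?_
    rw [← Real.rpow_mul (hwpos α hα).le, ← Real.rpow_add (hwpos α hα)]
    congr 1
    ring
  have hgP : circuitPoly P γ (fun α => μ α * (t * w α)) (-(t * W)) ∈ SONCGen A :=
    hbarP.circuitPoly_mem_SONCGen
      (hbarP.isCircuitOn (hPS.trans hS.subset) (fun α hα => hS.even_mem α (hPS hα)) hγA hindP)
      (fun α hα => mul_pos (hPpos α hα) (mul_pos htpos (hwpos α (hPS hα))))
      (by rw [hΘP, abs_neg, abs_of_pos (mul_pos htpos hWpos)])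
  have hgT : circuitPoly (insert γ T) β (fun α => ν α * w' α) d ∈ SONCGen A := by
    refine hbarT.circuitPoly_mem_SONCGen (hbarT.isCircuitOn
      (Finset.insert_subset hγA (hTS.trans hS.subset)) ?_ hS.beta_mem hindT) ?_
      (by rw [hΘT, hd])
    · intro α hα
      rcases Finset.mem_insert.1 hα with rfl | hα
      · exact hγ
      · exact hS.even_mem α (hTS hα)
    · intro α hα
      refine mul_pos (hbarT.1 α hα) ?_
      rcases Finset.mem_insert.1 hα with rfl | hα
      · rw [hw'γ]; exact hWpos
      · rw [hw'T α hα]; exact hwpos α (hTS hα)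
  refine ⟨_, hgP, _, hgT, ?_, ?_⟩
  · have e1 : ∑ α ∈ P, monomial α (μ α * (t * w α)) =
        ∑ α ∈ S, monomial α (μ α * (t * w α)) :=
      Finset.sum_subset hPS fun α hα hαP => by rw [hμP α hα hαP, zero_mul, monomial_zero]
    have e2 : ∑ α ∈ T, monomial α (ν α * w' α) =
        ∑ α ∈ S, monomial α ((lam α - t * μ α) * w α) := by
      rw [Finset.sum_congr rfl fun α hα => by rw [hνT α hα, hw'T α hα]]
      exact Finset.sum_subset hTS fun α hα hαT => by
        rw [hT0 α hα hαT, zero_mul, monomial_zero]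
    have e3 : ∑ α ∈ S, monomial α (c α) = ∑ α ∈ S, monomial α (μ α * (t * w α)) +
        ∑ α ∈ S, monomial α ((lam α - t * μ α) * w α) := by
      rw [← Finset.sum_add_distrib]
      refine Finset.sum_congr rfl fun α hα => ?_
      rw [← map_add, ← hlw α hα]
      congr 1
      ring
    rw [circuitPoly, circuitPoly, circuitPoly, Finset.sum_insert hγT, e1, e2, e3, hνγ, hw'γ,
      map_neg]
    abel
  · rw [coeff_circuitPoly, if_neg hγP, if_pos rfl, zero_add]
    exact neg_ne_zero.2 (mul_pos htpos hWpos).ne'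

/-- The circuit supporting an extreme circuit polynomial is reduced. -/
theorem IsExtremeRay.isReducedCircuitOn
    (hf : IsExtremeRay (SONCCone A) (circuitPoly S β c d)) (hS : IsCircuitOn A S β)
    (hc : ∀ α ∈ S, 0 < c α) (hl : IsBarycentric S β lam)
    (hd : |d| = circuitNumber S c lam) : IsReducedCircuitOn A S β := by
  refine ⟨hS, Set.ext fun γ => ⟨?_, ?_⟩⟩
  · rintro ⟨hγA, hγ, hconv⟩
    refine ⟨?_, hγ⟩
    by_contra! hcon
    obtain ⟨g, hg, h, hh, hsum, hne⟩ :=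
      exists_split_of_mem_convexHull hS hc hl hd hγA hγ hconv hcon.1
    obtain ⟨t, -, he⟩ := (hf.2.2 g h (mem_SONCCone_of_mem_SONCGen hg)
      (mem_SONCCone_of_mem_SONCGen hh) hsum).1
    apply hne
    rw [he, coeff_smul, coeff_circuitPoly, if_neg hcon.1, if_neg hcon.2.symm]
    simp
  · rintro ⟨hγ | rfl, hev⟩
    · exact ⟨hS.subset hγ, hev, subset_convexHull ℝ _ ⟨γ, hγ, rfl⟩⟩
    · exact ⟨hS.beta_mem, hev, intrinsicInterior_subset hS.relint⟩

end Cone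

/-- **Characterization of the extreme rays of the SONC cone** (Katthän–Naumann–Theobald).
Every extreme ray is generated by a monomial square, by a nonnegative circuit polynomial
`∑ c_α x^α − Θ_f x^β` on a reduced circuit with `|S| > 1`, or by a circuit polynomial
`∑ c_α x^α + Θ_f x^β` on an odd reduced circuit with `|S| > 1`. -/
theorem sonc_extreme_ray_classification {n : ℕ} (A : Finset (Fin n →₀ ℕ))
    (f : MvPolynomial (Fin n) ℝ) (hf : IsExtremeRay (SONCCone A) f) :
    ∃ g : MvPolynomial (Fin n) ℝ, raySet f = raySet g ∧
      ((∃ β ∈ A, IsEvenPt β ∧ g = monomial β 1) ∨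
       (∃ S β c lam, IsReducedCircuitOn A S β ∧ 1 < S.card ∧
          (∀ α ∈ S, 0 < c α) ∧ IsBarycentric S β lam ∧
          g = circuitPoly S β c (-(circuitNumber S c lam))) ∨
       (∃ S β c lam, IsReducedCircuitOn A S β ∧ 1 < S.card ∧ ¬ IsEvenPt β ∧
          (∀ α ∈ S, 0 < c α) ∧ IsBarycentric S β lam ∧
          g = circuitPoly S β c (circuitNumber S c lam))) := by
  classical
  obtain ⟨g, hg, s, hs, rfl⟩ := hf.exists_generator
  rcases SONCGen.eq_circuitPoly_or_monomial hg hs with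
    ⟨S, β, c, d, hS, hc, he, hx⟩ | ⟨α, hα, hev, he⟩
  swap
  · exact ⟨_, he, Or.inl ⟨α, hα, hev, rfl⟩⟩
  rw [he] at hf hx ⊢
  obtain ⟨lam, hl⟩ := exists_isBarycentric hS.indep hS.relint
  rcases lt_or_ge 1 S.card with hcard | hcard
  · refine ⟨_, rfl, Or.inr ?_⟩
    have hΘ := circuitNumber_pos hc hl.1
    rcases hf.eq_circuitNumber hS hcard hc hl hx with rfl | ⟨hβ, rfl⟩
    · exact Or.inl ⟨S, β, c, lam, hf.isReducedCircuitOn hS hc hl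
        (by rw [abs_neg, abs_of_pos hΘ]), hcard, hc, hl, rfl⟩
    · exact Or.inr ⟨S, β, c, lam, hf.isReducedCircuitOn hS hc hl (abs_of_pos hΘ), hcard, hβ,
        hc, hl, rfl⟩
  · obtain ⟨α, rfl⟩ : ∃ α, S = {α} := by
      rw [← Finset.card_eq_one]
      refine le_antisymm hcard (Finset.card_pos.2 (Finset.nonempty_iff_ne_empty.2 ?_))
      rintro rfl
      simpa using hl.2.1
    have hβ : β = α := by
      ext i
      have h1 := hl.2.1
      have h2 := hl.2.2 i
      simp only [Finset.sum_singleton] at h1 h2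
      rw [h1, one_mul] at h2
      exact_mod_cast h2
    subst hβ
    have hm : circuitPoly {β} β c d = (c β + d) • monomial β 1 := by
      rw [circuitPoly, Finset.sum_singleton, ← map_add, smul_monomial, smul_eq_mul, mul_one]
    have hnn : 0 ≤ c β + d := by
      have := hx (fun _ => 1)
      rw [eval_circuitPoly] at this
      simpa using this
    have hpos : 0 < c β + d := by
      refine lt_of_le_of_ne hnn fun h0 => hf.1 ?_
      rw [hm, ← h0, zero_smul]
    exact ⟨_, by rw [hm, raySet_smul hpos],
      Or.inl ⟨β, hS.beta_mem, hS.even_mem β (Finset.mem_singleton_self β), rfl⟩⟩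
end

section
/- Let A ⊆ ℕ^n be a finite set and let γ ∈ A ∩ (2ℕ)^n be such that there exists a circuit (S, β) on A with |S| > 1, γ ∈ S, and β even. Then the extreme ray r = ℝ₊·x^γ of the SONC cone C(A) is not exposed; that is, there is no linear functional l on the space of polynomials supported on A with l(x^γ) = 0 and l(g) > 0 for all g ∈ C(A) \ ℝ₊·x^γ. -/
open MvPolynomial Finset

/-- A point in the intrinsic interior of a convex set can be pushed slightly beyond itself, away
from any other point of the set. -/
theorem exists_lineMap_neg_mem_of_mem_intrinsicInterior {V : Type*} [NormedAddCommGroup V]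
    [NormedSpace ℝ V] {s : Set V} {x y : V} (hx : x ∈ intrinsicInterior ℝ s) (hy : y ∈ s) :
    ∃ ε : ℝ, 0 < ε ∧ AffineMap.lineMap x y (-ε) ∈ s := by
  obtain ⟨x', hx', rfl⟩ := mem_intrinsicInterior.1 hx
  have hcont : Continuous fun t : ℝ => (⟨AffineMap.lineMap (x' : V) y (-t),
      AffineMap.lineMap_mem _ x'.2 (subset_affineSpan ℝ s hy)⟩ : affineSpan ℝ s) := by
    refine Continuous.subtype_mk ?_ _
    exact AffineMap.lineMap_continuous.comp continuous_neg
  have hopen := hcont.isOpen_preimage _ (isOpen_interior (s := ((↑) : affineSpan ℝ s → V) ⁻¹' s))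
  have hev : ∀ᶠ t : ℝ in nhds 0, AffineMap.lineMap (x' : V) y (-t) ∈ s := by
    filter_upwards [hopen.mem_nhds (x := 0) (by simpa using hx')] with t ht
    have ht' := interior_subset (Set.mem_preimage.1 ht)
    exact ht'
  obtain ⟨ε, h, hε⟩ := ((hev.filter_mono (nhdsWithin_le_nhds (s := Set.Ioi 0))).and
    self_mem_nhdsWithin).exists
  exact ⟨ε, hε, h⟩

/-- A point of the convex hull of finitely many points is a convex combination of them. -/
theorem exists_weights_of_mem_convexHull_image {ι V : Type*} [AddCommGroup V] [Module ℝ V]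
    {S : Finset ι} {p : ι → V} {x : V} (hx : x ∈ convexHull ℝ (p '' (S : Set ι))) :
    ∃ v : ι → ℝ, (∀ i ∈ S, 0 ≤ v i) ∧ ∑ i ∈ S, v i = 1 ∧ ∑ i ∈ S, v i • p i = x := by
  classical
  obtain ⟨κ, _, w, z, hw, hw1, hz, rfl⟩ := mem_convexHull_iff_exists_fintype.1 hx
  choose j hj hjz using hz
  refine ⟨fun i => ∑ k with j k = i, w k, fun i _ => Finset.sum_nonneg fun k _ => hw k, ?_, ?_⟩
  · rw [Finset.sum_fiberwise_of_maps_to fun k _ => hj k, hw1]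
  · rw [← Finset.sum_fiberwise_of_maps_to (fun k _ => hj k) fun k => w k • z k]
    refine Finset.sum_congr rfl fun i _ => ?_
    rw [Finset.sum_smul]
    refine Finset.sum_congr rfl fun k hk => ?_
    rw [← hjz k, (Finset.mem_filter.1 hk).2]

/-- A point in the intrinsic interior of the convex hull of finitely many points is a convex
combination of them with strictly positive weights. -/
theorem exists_pos_weights_of_mem_intrinsicInterior_convexHull {ι V : Type*}
    [NormedAddCommGroup V] [NormedSpace ℝ V] {S : Finset ι} {p : ι → V} {x : V}
    (hx : x ∈ intrinsicInterior ℝ (convexHull ℝ (p '' (S : Set ι)))) :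
    ∃ w : ι → ℝ, (∀ i ∈ S, 0 < w i) ∧ ∑ i ∈ S, w i = 1 ∧ ∑ i ∈ S, w i • p i = x := by
  classical
  have hne : S.Nonempty := by
    by_contra h
    rw [Finset.not_nonempty_iff_eq_empty] at h
    subst h
    simp at hx
  have hcard : (0 : ℝ) < S.card := by exact_mod_cast hne.card_pos
  have hcsum : ∑ _i ∈ S, (S.card : ℝ)⁻¹ = 1 := by
    simp [hcard.ne']
  have hc : ∑ i ∈ S, (S.card : ℝ)⁻¹ • p i ∈ convexHull ℝ (p '' (S : Set ι)) :=
    (convex_convexHull ℝ _).sum_mem (fun _ _ => by positivity) hcsum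
      fun i hi => subset_convexHull ℝ _ ⟨i, hi, rfl⟩
  obtain ⟨ε, hε, h⟩ := exists_lineMap_neg_mem_of_mem_intrinsicInterior hx hc
  obtain ⟨v, hv0, hv1, hv⟩ := exists_weights_of_mem_convexHull_image h
  refine ⟨fun i => (v i + ε * (S.card : ℝ)⁻¹) / (1 + ε), fun i hi => ?_, ?_, ?_⟩
  · have := hv0 i hi
    positivity
  · rw [← Finset.sum_div, Finset.sum_add_distrib, ← Finset.mul_sum, hv1, hcsum]
    field_simp
  · have h1 : (1 + ε) ≠ 0 := by positivity
    have : ∑ i ∈ S, ((v i + ε * (S.card : ℝ)⁻¹) / (1 + ε)) • p i =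
        (1 + ε)⁻¹ • (∑ i ∈ S, v i • p i + ε • ∑ i ∈ S, (S.card : ℝ)⁻¹ • p i) := by
      rw [Finset.smul_sum, ← Finset.sum_add_distrib, Finset.smul_sum]
      refine Finset.sum_congr rfl fun i _ => ?_
      module
    rw [this, hv, AffineMap.lineMap_apply_module, inv_smul_eq_iff₀ h1]
    module

/-- Weighted AM-GM for monomials with even exponents. -/
theorem eval_monomial_le_of_barycentric {n : ℕ} {S : Finset (Fin n →₀ ℕ)} {β : Fin n →₀ ℕ}
    {lam u : (Fin n →₀ ℕ) → ℝ} (hlam : IsBarycentric S β lam) (hS : ∀ α ∈ S, IsEvenPt α)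
    (hu : ∀ α ∈ S, 0 ≤ u α) (hprod : ∏ α ∈ S, u α ^ lam α = 1) (x : Fin n → ℝ) :
    ∏ i, x i ^ β i ≤ ∑ α ∈ S, lam α * u α * ∏ i, x i ^ α i := by
  obtain ⟨hpos, hsum, hβ⟩ := hlam
  have habs : ∀ α ∈ S, ∏ i, x i ^ α i = ∏ i, |x i| ^ α i := fun α hα =>
    Finset.prod_congr rfl fun i _ => ((hS α hα i).pow_abs (x i)).symm
  have hamgm := Real.geom_mean_le_arith_mean_weighted S lam (fun α => u α * ∏ i, |x i| ^ α i)
    (fun α hα => (hpos α hα).le) hsum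
    (fun α hα => mul_nonneg (hu α hα) (Finset.prod_nonneg fun i _ => by positivity))
  have hgeom : ∏ α ∈ S, (u α * ∏ i, |x i| ^ α i) ^ lam α = ∏ i, |x i| ^ β i := by
    calc ∏ α ∈ S, (u α * ∏ i, |x i| ^ α i) ^ lam α
        = ∏ α ∈ S, u α ^ lam α * ∏ i, |x i| ^ (lam α * (α i : ℝ)) := by
          refine Finset.prod_congr rfl fun α hα => ?_
          rw [Real.mul_rpow (hu α hα) (Finset.prod_nonneg fun i _ => by positivity),
            ← Real.finsetProd_rpow _ _ fun i _ => by positivity]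
          congr 1
          refine Finset.prod_congr rfl fun i _ => ?_
          rw [← Real.rpow_natCast, ← Real.rpow_mul (abs_nonneg _), mul_comm]
      _ = ∏ i, |x i| ^ β i := by
          rw [Finset.prod_mul_distrib, hprod, one_mul, Finset.prod_comm]
          refine Finset.prod_congr rfl fun i _ => ?_
          rw [← Real.rpow_natCast, hβ i, Real.rpow_sum_of_nonneg (abs_nonneg _)
            fun α hα => mul_nonneg (hpos α hα).le (Nat.cast_nonneg _)]
  calc ∏ i, x i ^ β i ≤ |∏ i, x i ^ β i| := le_abs_self _
    _ = ∏ i, |x i| ^ β i := by simp [Finset.abs_prod, abs_pow]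
    _ ≤ _ := hgeom ▸ hamgm
    _ = _ := Finset.sum_congr rfl fun α hα => by rw [habs α hα, mul_assoc]

theorem SONCGen.mem_SONCCone {n : ℕ} {A : Finset (Fin n →₀ ℕ)} {f : MvPolynomial (Fin n) ℝ}
    (hf : f ∈ SONCGen A) : f ∈ SONCCone A :=
  ⟨1, fun _ => f, fun _ => 1, fun _ => ⟨hf, zero_le_one⟩, by simp⟩

/-- A monomial lies on the ray of another monomial only if the exponents agree. -/
theorem eq_of_monomial_mem_raySet {n : ℕ} {α γ : Fin n →₀ ℕ}
    (h : (monomial α (1 : ℝ) : MvPolynomial (Fin n) ℝ) ∈ raySet (monomial γ 1)) : α = γ := by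
  obtain ⟨t, -, ht⟩ := h
  by_contra hne
  have := congrArg (coeff α) ht
  simp [coeff_monomial, Ne.symm hne] at this

theorem IsCircuitOn.exists_isBarycentric {n : ℕ} {A S : Finset (Fin n →₀ ℕ)} {β : Fin n →₀ ℕ}
    (h : IsCircuitOn A S β) : ∃ lam, IsBarycentric S β lam := by
  obtain ⟨w, hw, hw1, hwβ⟩ := exists_pos_weights_of_mem_intrinsicInterior_convexHull h.relint
  refine ⟨w, hw, hw1, fun i => ?_⟩
  have := congrFun hwβ i
  simpa [toR, Finset.sum_apply] using this.symm

/-- The inner exponent of a circuit with more than one vertex is not a vertex. -/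
theorem IsCircuitOn.ne_of_mem {n : ℕ} {A S : Finset (Fin n →₀ ℕ)} {β γ : Fin n →₀ ℕ}
    (h : IsCircuitOn A S β) (hcard : 1 < S.card) (hγ : γ ∈ S) : β ≠ γ := by
  classical
  rintro rfl
  obtain ⟨lam, hpos, hsum, hbary⟩ := h.exists_isBarycentric
  obtain ⟨α, hα, hne⟩ := Finset.exists_mem_ne hcard β
  have hind := (affineIndependent_iff.1 h.indep) Finset.univ
    (fun σ => lam σ - if (σ : Fin n →₀ ℕ) = β then 1 else 0) (by
      rw [Finset.sum_coe_sort S (fun σ => lam σ - if σ = β then 1 else 0)]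
      simp [hsum, hγ]) (by
      rw [Finset.sum_coe_sort S (fun σ => (lam σ - if σ = β then 1 else 0) • toR σ)]
      funext i
      simp [Finset.sum_apply, sub_mul, toR, ← hbary i, hγ]) ⟨α, hα⟩ (Finset.mem_univ _)
  have := hpos α hα
  simp only [hne, if_false, sub_zero] at hind
  exact this.ne' hind

/-- A nonnegative circuit polynomial with inner coefficient `-1`, whose outer coefficients are
`lam α * u α` for weights `u` of weighted geometric mean one. -/
theorem IsCircuitOn.circuitPoly_mem_SONCCone {n : ℕ} {A S : Finset (Fin n →₀ ℕ)}
    {β : Fin n →₀ ℕ} (h : IsCircuitOn A S β) {lam u : (Fin n →₀ ℕ) → ℝ}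
    (hlam : IsBarycentric S β lam) (hu : ∀ α ∈ S, 0 < u α)
    (hprod : ∏ α ∈ S, u α ^ lam α = 1) :
    circuitPoly S β (fun α => lam α * u α) (-1) ∈ SONCCone A := by
  refine SONCGen.mem_SONCCone (Or.inl ⟨S, β, _, _, h,
    fun α hα => mul_pos (hlam.1 α hα) (hu α hα), rfl, fun x => ?_⟩)
  have := eval_monomial_le_of_barycentric hlam h.even_mem (fun α hα => (hu α hα).le) hprod x
  simp only [circuitPoly, map_add, map_sum, eval_monomial,
    Finsupp.prod_fintype _ _ fun _ => pow_zero _]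
  linarith

/-- **Unexposedness of monomial extreme rays lying on even circuits.** If
`γ ∈ A ∩ (2ℕ)ⁿ` belongs to some circuit `(S, β)` on `A` with `|S| > 1` and `β` even,
then the extreme ray `ℝ₊ · x^γ` of the SONC cone is not exposed: no linear functional
vanishes at `x^γ` and is strictly positive on the rest of the cone. -/
theorem monomial_ray_not_exposed {n : ℕ} (A : Finset (Fin n →₀ ℕ)) (γ : Fin n →₀ ℕ)
    (hγA : γ ∈ A) (hγeven : IsEvenPt γ) (S : Finset (Fin n →₀ ℕ)) (β : Fin n →₀ ℕ)
    (hcirc : IsCircuitOn A S β) (hcard : 1 < S.card) (hγS : γ ∈ S) (hβ : IsEvenPt β)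
    (hext : IsExtremeRay (SONCCone A) ((monomial γ (1 : ℝ) : MvPolynomial (Fin n) ℝ))) :
    ¬ ∃ l : MvPolynomial (Fin n) ℝ →ₗ[ℝ] ℝ,
        l (monomial γ (1 : ℝ)) = 0 ∧
        ∀ g ∈ SONCCone A \ raySet ((monomial γ (1 : ℝ) : MvPolynomial (Fin n) ℝ)),
          0 < l g := by
  classical
  rintro ⟨l, hlγ, hl⟩
  have hnonneg : ∀ g ∈ SONCCone A, 0 ≤ l g := fun g hg => by
    by_cases hr : g ∈ raySet (monomial γ (1 : ℝ) : MvPolynomial (Fin n) ℝ)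
    · obtain ⟨t, -, rfl⟩ := hr
      simp [hlγ]
    · exact (hl g ⟨hg, hr⟩).le
  have hlβ : 0 < l (monomial β 1) :=
    hl _ ⟨SONCGen.mem_SONCCone (Or.inr ⟨β, hcirc.beta_mem, hβ, rfl⟩),
      fun h => hcirc.ne_of_mem hcard hγS (eq_of_monomial_mem_raySet h)⟩
  obtain ⟨lam, hlam⟩ := hcirc.exists_isBarycentric
  have hlmon : ∀ (α : Fin n →₀ ℕ) (c : ℝ), l (monomial α c) = c * l (monomial α 1) :=
    fun α c => by rw [← smul_eq_mul, ← map_smul, smul_monomial, smul_eq_mul, mul_one]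
  set M := ∑ α ∈ S, lam α * l (monomial α 1) with hM
  have hM0 : 0 ≤ M := Finset.sum_nonneg fun α hα => mul_nonneg (hlam.1 α hα).le
    (hnonneg _ (SONCGen.mem_SONCCone
      (Or.inr ⟨α, hcirc.subset hα, hcirc.even_mem α hα, rfl⟩)))
  obtain ⟨ε, hε, hεM⟩ : ∃ ε : ℝ, 0 < ε ∧ ε * M < l (monomial β 1) :=
    ⟨l (monomial β 1) / (M + 1), by positivity, by
      rw [div_mul_eq_mul_div, div_lt_iff₀ (by positivity)]
      nlinarith⟩
  have hγpos := hlam.1 γ hγS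
  have hsum : ∑ α ∈ S.erase γ, lam α = 1 - lam γ := by
    rw [← hlam.2.1, ← Finset.add_sum_erase S lam hγS]
    ring
  let u : (Fin n →₀ ℕ) → ℝ := fun α => if α = γ then ε ^ (-(1 - lam γ) / lam γ) else ε
  have hu : ∀ α, 0 < u α := fun α => by
    dsimp only [u]
    split_ifs <;> positivity
  have hprod : ∏ α ∈ S, u α ^ lam α = 1 := by
    have herase : ∏ α ∈ S.erase γ, u α ^ lam α = ε ^ (1 - lam γ) := by
      rw [← hsum, Real.rpow_sum_of_pos hε]
      exact Finset.prod_congr rfl fun α hα => by simp [u, Finset.ne_of_mem_erase hα]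
    rw [← Finset.mul_prod_erase S _ hγS, herase]
    simp only [u, if_true]
    rw [← Real.rpow_mul hε.le, ← Real.rpow_add hε, div_mul_cancel₀ _ hγpos.ne']
    simp
  have hmem := hnonneg _ (hcirc.circuitPoly_mem_SONCCone hlam (fun α _ => hu α) hprod)
  have hval : l (circuitPoly S β (fun α => lam α * u α) (-1)) =
      ε * M - l (monomial β 1) := by
    rw [circuitPoly, map_add, map_sum, hlmon β, hM, Finset.mul_sum, neg_one_mul,
      ← sub_eq_add_neg]
    congr 1
    refine Finset.sum_congr rfl fun α _ => ?_
    by_cases h : α = γ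
    · subst h
      rw [hlmon, hlγ]
      ring
    · rw [hlmon]
      simp only [u, h, if_false]
      ring
  linarith
end
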